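/- Let u, v : ℝ^N → ℝ be positive continuous radial functions with u(x) ~ |x|^a e^{−b|x|} and v(x) ~ |x|^{a'} e^{−b|x|} as |x| → ∞, with b > 0 and a ≥ a' > −(N+1)/2. Then as |ξ| → ∞, ∫_{ℝ^N} u(x − ξ) v(x) dx ~ C e^{−b|ξ|} |ξ|^{a + a' + (N+1)/2} for some constant C > 0. -/

import Mathlib

open MeasureTheory Filter Topology

theorem exists_rpow_le_mul_exp {m c : ℝ} (hm : 0 ≤ m) (hc : 0 < c) :
    ∃ C > 0, ∀ x : ℝ, 0 ≤ x → x ^ m ≤ C * Real.exp (c * x) := by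
  rcases hm.eq_or_lt with rfl | hm
  · refine ⟨1, one_pos, fun x hx => ?_⟩
    simpa using mul_nonneg hc.le hx
  · refine ⟨(m / c) ^ m, by positivity, fun x hx => ?_⟩
    have hle : c * x / m ≤ Real.exp (c * x / m) := by
      linarith [Real.add_one_le_exp (c * x / m)]
    calc x ^ m = (m / c * (c * x / m)) ^ m := by congr 1; field_simp
      _ = (m / c) ^ m * (c * x / m) ^ m := Real.mul_rpow (by positivity) (by positivity)
      _ ≤ (m / c) ^ m * Real.exp (c * x / m) ^ m := by gcongr
      _ = (m / c) ^ m * Real.exp (c * x) := by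
        rw [← Real.exp_mul]; congr 2; field_simp

theorem exists_le_mul_one_add_rpow_mul_exp {U : ℝ → ℝ} {a b c : ℝ} (hU : Continuous U)
    (h : Tendsto (fun r => U r / (r ^ a * Real.exp (-b * r))) atTop (𝓝 c)) :
    ∃ K > 0, ∀ r, 0 ≤ r → U r ≤ K * ((1 + r) ^ a * Real.exp (-b * r)) := by
  have hratio : Tendsto (fun r : ℝ => (r / (1 + r)) ^ a) atTop (𝓝 1) := by
    have h1 : Tendsto (fun r : ℝ => 1 - (1 + r)⁻¹) atTop (𝓝 (1 - 0)) :=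
      tendsto_const_nhds.sub (tendsto_inv_atTop_zero.comp (tendsto_atTop_add_const_left _ 1 tendsto_id))
    have h2 := h1.rpow_const (p := a) (Or.inl (by norm_num))
    rw [sub_zero, Real.one_rpow] at h2
    refine h2.congr' ?_
    filter_upwards [eventually_gt_atTop 0] with r hr
    congr 1
    field_simp
    ring
  have hlim : Tendsto (fun r => U r / ((1 + r) ^ a * Real.exp (-b * r))) atTop (𝓝 (c * 1)) := by
    refine (h.mul hratio).congr' ?_
    filter_upwards [eventually_gt_atTop 0] with r hr
    rw [Real.div_rpow hr.le (by positivity)]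
    have := Real.rpow_pos_of_pos hr a
    have := Real.rpow_pos_of_pos (by positivity : 0 < 1 + r) a
    field_simp
  obtain ⟨M, hM⟩ := eventually_atTop.1 (hlim.eventually (eventually_le_nhds (lt_add_one _)))
  have hcont : ContinuousOn (fun r => U r / ((1 + r) ^ a * Real.exp (-b * r))) (Set.Icc 0 M) := by
    refine hU.continuousOn.div (ContinuousOn.mul (ContinuousOn.rpow_const (by fun_prop) ?_)
      (by fun_prop)) ?_
    · intro r hr
      exact Or.inl (by linarith [hr.1])
    · intro r hr
      have := Real.rpow_pos_of_pos (by linarith [hr.1] : 0 < 1 + r) a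
      positivity
  obtain ⟨L, hL⟩ := (isCompact_Icc.image_of_continuousOn hcont).bddAbove
  refine ⟨max 1 (max (c * 1 + 1) L), by positivity, fun r hr => ?_⟩
  have hpos := Real.rpow_pos_of_pos (by linarith : 0 < 1 + r) a
  rw [← div_le_iff₀ (by positivity)]
  rcases le_total M r with hr' | hr'
  · exact (hM r hr').trans (le_max_of_le_right (le_max_left _ _))
  · exact (hL ⟨r, ⟨hr, hr'⟩, rfl⟩).trans (le_max_of_le_right (le_max_right _ _))

theorem integrable_norm_rpow_mul_exp {E : Type*} [NormedAddCommGroup E] [NormedSpace ℝ E]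
    [FiniteDimensional ℝ E] [MeasurableSpace E] [BorelSpace E] (μ : Measure E)
    [μ.IsAddHaarMeasure] {l c : ℝ} (hl : l < 1) (hc : 0 < c) :
    Integrable (fun y : E => ‖y‖ ^ (-(Module.finrank ℝ E * l)) * Real.exp (-c * ‖y‖)) μ := by
  cases subsingleton_or_nontrivial E
  · have : CompactSpace E := Finite.compactSpace
    have hf : (fun y : E => ‖y‖ ^ (-(Module.finrank ℝ E * l)) * Real.exp (-c * ‖y‖)) = fun _ => 1 := by
      ext y
      simp [Subsingleton.elim y 0, Module.finrank_zero_of_subsingleton]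
    rw [hf]
    exact integrable_const _
  · rw [integrable_fun_norm_addHaar μ (f := fun r => r ^ (-(Module.finrank ℝ E * l)) * Real.exp (-c * r))]
    have hd : (1 : ℝ) ≤ Module.finrank ℝ E := by exact_mod_cast Module.finrank_pos (R := ℝ) (M := E)
    have := integrableOn_rpow_mul_exp_neg_mul_rpow (p := 1)
      (s := (Module.finrank ℝ E - 1) + -(Module.finrank ℝ E * l)) (by nlinarith) one_pos hc
    refine this.congr_fun (fun r hr => ?_) measurableSet_Ioi
    have hr : 0 < r := hr
    simp only [Real.rpow_one, smul_eq_mul, Real.rpow_add hr]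
    rw [← mul_assoc, ← Real.rpow_natCast, Nat.cast_sub (by exact_mod_cast hd), Nat.cast_one]

theorem integral_prod_comp_smul_smul {E : Type*} [NormedAddCommGroup E] [NormedSpace ℝ E]
    [FiniteDimensional ℝ E] [MeasurableSpace E] [BorelSpace E] (μ : Measure E)
    [μ.IsAddHaarMeasure] (f : ℝ × E → ℝ) {p q : ℝ} (hp : 0 < p) (hq : 0 < q) :
    ∫ z, f z ∂(volume.prod μ) =
      p * q ^ Module.finrank ℝ E * ∫ z : ℝ × E, f (p * z.1, q • z.2) ∂(volume.prod μ) := by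
  let e : ℝ × E ≃ᵐ ℝ × E :=
    ((Homeomorph.smulOfNeZero p hp.ne').prodCongr (Homeomorph.smulOfNeZero q hq.ne')).toMeasurableEquiv
  have he : ⇑e = Prod.map (fun x : ℝ => p • x) (fun y : E => q • y) := rfl
  have hmap := Measure.map_prod_map (volume : Measure ℝ) μ (f := fun x : ℝ => p • x)
    (g := fun y : E => q • y) (by fun_prop) (by fun_prop)
  rw [Measure.map_addHaar_smul _ hp.ne', Measure.map_addHaar_smul _ hq.ne',
    Measure.prod_smul_left, Measure.prod_smul_right, ← he] at hmap
  have h := e.measurableEmbedding.integral_map (μ := volume.prod μ) f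
  rw [← hmap, integral_smul_measure, integral_smul_measure] at h
  have h' : ∫ z : ℝ × E, f (p * z.1, q • z.2) ∂(volume.prod μ) = ∫ z, f (e z) ∂(volume.prod μ) := rfl
  rw [h', ← h, ENNReal.toReal_ofReal (abs_nonneg _), ENNReal.toReal_ofReal (abs_nonneg _),
    abs_of_pos (by positivity), abs_of_pos (by positivity)]
  simp only [Module.finrank_self, pow_one, smul_eq_mul]
  field_simp

theorem integral_mul_eq_integral_prod {n : ℕ} {u v : EuclideanSpace ℝ (Fin (n + 1)) → ℝ}
    {U V : ℝ → ℝ} (hu : ∀ x, u x = U ‖x‖) (hv : ∀ x, v x = V ‖x‖)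
    (ξ : EuclideanSpace ℝ (Fin (n + 1))) :
    ∫ x, u (x - ξ) * v x = ∫ z : ℝ × EuclideanSpace ℝ (Fin n),
      U (√((z.1 - ‖ξ‖) ^ 2 + ‖z.2‖ ^ 2)) * V (√(z.1 ^ 2 + ‖z.2‖ ^ 2)) := by
  have hdim : Module.finrank ℝ (WithLp 2 (ℝ × EuclideanSpace ℝ (Fin n))) =
      Module.finrank ℝ (EuclideanSpace ℝ (Fin (n + 1))) := by
    rw [(WithLp.linearEquiv 2 ℝ (ℝ × EuclideanSpace ℝ (Fin n))).finrank_eq]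
    simp [add_comm]
  let T₀ := (stdOrthonormalBasis ℝ (WithLp 2 (ℝ × EuclideanSpace ℝ (Fin n)))).equiv
    (stdOrthonormalBasis ℝ (EuclideanSpace ℝ (Fin (n + 1)))) (finCongr hdim)
  let p : WithLp 2 (ℝ × EuclideanSpace ℝ (Fin n)) := WithLp.toLp 2 (‖ξ‖, 0)
  have hp : ‖T₀ p‖ = ‖ξ‖ := by
    rw [T₀.norm_map]
    simp [p]
  let T := T₀.trans (ℝ ∙ (T₀ p - ξ))ᗮ.reflection
  have hTp : T p = ξ := Submodule.reflection_sub hp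
  have h₁ := T.measurePreserving.integral_comp T.toHomeomorph.measurableEmbedding
    (fun x => u (x - ξ) * v x)
  have h₂ := (WithLp.volume_preserving_toLp ℝ (EuclideanSpace ℝ (Fin n))).integral_comp
    (MeasurableEquiv.toLp 2 (ℝ × EuclideanSpace ℝ (Fin n))).measurableEmbedding
    (fun z => u (T z - ξ) * v (T z))
  rw [← h₁, ← h₂]
  congr 1 with z
  rw [← hTp, ← map_sub, hu, hv, T.norm_map, T.norm_map, WithLp.prod_norm_eq_of_L2,
    WithLp.prod_norm_eq_of_L2]
  simp [p]

theorem abs_le_sqrt_sq_add_sq_div {R : ℝ} (hR : 1 ≤ R) (t y : ℝ) :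
    |t| ≤ √(t ^ 2 + y ^ 2 / R) :=
  Real.abs_le_sqrt (le_add_of_nonneg_right (by positivity))

theorem sqrt_sq_add_sq_div_le {R : ℝ} (hR : 1 ≤ R) (t : ℝ) {y : ℝ} (hy : 0 ≤ y) :
    √(t ^ 2 + y ^ 2 / R) ≤ |t| + y := by
  refine Real.sqrt_le_iff.2 ⟨by positivity, ?_⟩
  have : y ^ 2 / R ≤ y ^ 2 := div_le_self (sq_nonneg y) hR
  nlinarith [sq_abs t, mul_nonneg (abs_nonneg t) hy]

theorem sq_le_two_mul_sqrt_mul {R : ℝ} (hR : 1 ≤ R) (t y : ℝ) :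
    y ^ 2 ≤ 2 * √(t ^ 2 + y ^ 2 / R) * (R * (√(t ^ 2 + y ^ 2 / R) - t)) := by
  have hts := (le_abs_self t).trans (abs_le_sqrt_sq_add_sq_div hR t y)
  have hsq : √(t ^ 2 + y ^ 2 / R) ^ 2 = t ^ 2 + y ^ 2 / R := Real.sq_sqrt (by positivity)
  have hR0 : 0 < R := by linarith
  set s := √(t ^ 2 + y ^ 2 / R)
  have hy : y ^ 2 = R * (s - t) * (s + t) := by
    have : y ^ 2 / R = s ^ 2 - t ^ 2 := by linarith
    rw [div_eq_iff hR0.ne'] at this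
    linarith
  have : 0 ≤ R * (s - t) := mul_nonneg hR0.le (by linarith)
  nlinarith

theorem sqrt_sq_add_sq_sub_le {R : ℝ} (hR : 1 ≤ R) (t y : ℝ) :
    √(t ^ 2 + y ^ 2) - t ≤ R * (√(t ^ 2 + y ^ 2 / R) - t) := by
  have hR0 : 0 < R := by linarith
  have hs : R * √(t ^ 2 + y ^ 2 / R) = √(R ^ 2 * t ^ 2 + R * y ^ 2) := by
    rw [← Real.sqrt_sq hR0.le, ← Real.sqrt_mul (by positivity), Real.sqrt_sq hR0.le]
    congr 1
    field_simp
  have h₁ : √(t ^ 2 + y ^ 2) ^ 2 = t ^ 2 + y ^ 2 := Real.sq_sqrt (by positivity)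
  have h₂ : √(t ^ 2 + y ^ 2) + (R - 1) * t ≤ √(R ^ 2 * t ^ 2 + R * y ^ 2) := by
    apply Real.le_sqrt_of_sq_le
    nlinarith [mul_nonneg (sub_nonneg.2 hR) (sq_nonneg (t - √(t ^ 2 + y ^ 2)))]
  rw [mul_sub, hs]
  linarith

theorem abs_add_div_two_sub_one_le {R : ℝ} (hR : 1 ≤ R) (t y : ℝ) :
    (|t| + y) / 2 - 1 ≤ R * (√(t ^ 2 + y ^ 2 / R) + √((1 - t) ^ 2 + y ^ 2 / R) - 1) := by
  have h₁ := sqrt_sq_add_sq_sub_le hR t y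
  have h₂ := sqrt_sq_add_sq_sub_le hR (1 - t) y
  have h₃ : (|t| + y) / 2 ≤ √(t ^ 2 + y ^ 2) := by
    apply Real.le_sqrt_of_sq_le
    nlinarith [sq_abs t, sq_nonneg (|t| - y)]
  have h₄ := Real.sqrt_nonneg ((1 - t) ^ 2 + y ^ 2)
  linarith

theorem exists_sqrt_rpow_mul_exp_le {b l q : ℝ} (hb : 0 < b) (hl : 0 ≤ l) (hq : 0 ≤ q) :
    ∃ C > 0, ∀ R t y : ℝ, 1 ≤ R → t ≠ 0 → 0 ≤ y → (y ≠ 0 ∨ q = 0) →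
      √(t ^ 2 + y ^ 2 / R) ^ (-(l + q / 2)) * Real.exp (-b * (R * (√(t ^ 2 + y ^ 2 / R) - t))) ≤
        C * (|t| ^ (-l) * y ^ (-q)) := by
  obtain ⟨C, hC, hle⟩ := exists_rpow_le_mul_exp (m := q / 2) (by positivity) (half_pos hb)
  refine ⟨C, hC, fun R t y hR ht hy0 hy => ?_⟩
  have ht' : 0 < |t| := abs_pos.2 ht
  have hts := abs_le_sqrt_sq_add_sq_div hR t y
  have hys := sq_le_two_mul_sqrt_mul hR t y
  set s := √(t ^ 2 + y ^ 2 / R)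
  have hs : 0 < s := ht'.trans_le hts
  have h₁ : s ^ (-l) ≤ |t| ^ (-l) := Real.rpow_le_rpow_of_nonpos ht' hts (by linarith)
  have h₂ : s ^ (-(q / 2)) * Real.exp (-b * (R * (s - t))) ≤ C * y ^ (-q) := by
    have h₃ : Real.exp (-b * (R * (s - t))) ≤ Real.exp (-(b / 2 * (y ^ 2 / s))) := by
      apply Real.exp_le_exp.2
      have : y ^ 2 / s ≤ 2 * (R * (s - t)) := by
        rw [div_le_iff₀ hs]; linarith
      nlinarith
    have h₄ : s ^ (-(q / 2)) = (y ^ 2 / s) ^ (q / 2) * y ^ (-q) := by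
      rcases hy with hy | rfl
      · have hy : 0 < y := lt_of_le_of_ne hy0 hy.symm
        rw [Real.div_rpow (by positivity) hs.le, ← Real.rpow_natCast, ← Real.rpow_mul hy.le,
          Real.rpow_neg hs.le, Real.rpow_neg hy.le]
        have := Real.rpow_pos_of_pos hy q
        norm_num
        field_simp
      · simp
    have hyq := Real.rpow_nonneg hy0 (-q)
    calc s ^ (-(q / 2)) * Real.exp (-b * (R * (s - t)))
        ≤ (C * Real.exp (b / 2 * (y ^ 2 / s)) * y ^ (-q)) * Real.exp (-(b / 2 * (y ^ 2 / s))) := by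
          rw [h₄]
          gcongr
          exact hle _ (by positivity)
      _ = C * y ^ (-q) * (Real.exp (b / 2 * (y ^ 2 / s)) * Real.exp (-(b / 2 * (y ^ 2 / s)))) := by
          ring
      _ = C * y ^ (-q) := by rw [← Real.exp_add, add_neg_cancel, Real.exp_zero, mul_one]
  calc s ^ (-(l + q / 2)) * Real.exp (-b * (R * (s - t)))
      = s ^ (-l) * (s ^ (-(q / 2)) * Real.exp (-b * (R * (s - t)))) := by
        rw [neg_add, Real.rpow_add hs, mul_assoc]
    _ ≤ |t| ^ (-l) * (C * y ^ (-q)) := by gcongr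
    _ = C * (|t| ^ (-l) * y ^ (-q)) := by ring

theorem rpow_neg_mul_rpow_mul_exp_le {a b α R s : ℝ} (hα : 0 ≤ α)
    (haα : 0 ≤ a + α) (hR : 1 ≤ R) (hs : 0 < s) :
    R ^ (-a) * ((1 + R * s) ^ a * Real.exp (-b * (R * s))) ≤
      s ^ (-α) * (1 + s) ^ (a + α) * Real.exp (-b * (R * s)) := by
  have hR0 : 0 < R := by linarith
  have hRi : R⁻¹ ≤ 1 := inv_le_one_of_one_le₀ hR
  rw [← mul_assoc]
  refine mul_le_mul_of_nonneg_right ?_ (Real.exp_pos _).le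
  calc R ^ (-a) * (1 + R * s) ^ a = (R⁻¹ + s) ^ a := by
        rw [Real.rpow_neg hR0.le, ← Real.inv_rpow hR0.le, ← Real.mul_rpow (by positivity) (by positivity)]
        congr 1
        field_simp
    _ = (R⁻¹ + s) ^ (-α) * (R⁻¹ + s) ^ (a + α) := by
        rw [← Real.rpow_add (by positivity)]
        congr 1
        ring
    _ ≤ s ^ (-α) * (1 + s) ^ (a + α) := by
        refine mul_le_mul (Real.rpow_le_rpow_of_nonpos hs ?_ (by linarith))
          (Real.rpow_le_rpow (by positivity) (by linarith) haα) (by positivity) (by positivity)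
        linarith [inv_pos.2 hR0]

theorem exists_sqrt_rpow_mul_sqrt_rpow_mul_exp_le {b l q : ℝ} (hb : 0 < b) (hl : 0 ≤ l)
    (hq : 0 ≤ q) :
    ∃ C > 0, ∀ R t y : ℝ, 1 ≤ R → t ≠ 0 → t ≠ 1 → 0 ≤ y → (y ≠ 0 ∨ q = 0) →
      √(t ^ 2 + y ^ 2 / R) ^ (-(l + q / 2)) * √((1 - t) ^ 2 + y ^ 2 / R) ^ (-(l + q / 2)) *
        Real.exp (-b * (R * (√(t ^ 2 + y ^ 2 / R) + √((1 - t) ^ 2 + y ^ 2 / R) - 1))) ≤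
        C * ((|t| ^ (-l) + |1 - t| ^ (-l)) * y ^ (-q)) := by
  obtain ⟨C, hC, hle⟩ := exists_sqrt_rpow_mul_exp_le hb hl hq
  have key : ∀ R t y : ℝ, 1 ≤ R → t ≠ 0 → 1 / 2 ≤ |1 - t| → 0 ≤ y → (y ≠ 0 ∨ q = 0) →
      √(t ^ 2 + y ^ 2 / R) ^ (-(l + q / 2)) * √((1 - t) ^ 2 + y ^ 2 / R) ^ (-(l + q / 2)) *
        Real.exp (-b * (R * (√(t ^ 2 + y ^ 2 / R) + √((1 - t) ^ 2 + y ^ 2 / R) - 1))) ≤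
        C * (1 / 2) ^ (-(l + q / 2)) * (|t| ^ (-l) * y ^ (-q)) := by
    intro R t y hR ht ht' hy0 hy
    have h₁ := hle R t y hR ht hy0 hy
    have h₂ := abs_le_sqrt_sq_add_sq_div hR (1 - t) y
    have h₂' := (le_abs_self _).trans h₂
    set s := √(t ^ 2 + y ^ 2 / R)
    set s' := √((1 - t) ^ 2 + y ^ 2 / R)
    have h₃ : s' ^ (-(l + q / 2)) ≤ (1 / 2) ^ (-(l + q / 2)) :=
      Real.rpow_le_rpow_of_nonpos (by norm_num) (ht'.trans h₂) (by linarith)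
    have h₄ : Real.exp (-b * (R * (s + s' - 1))) ≤ Real.exp (-b * (R * (s - t))) := by
      apply Real.exp_le_exp.2
      have : 0 ≤ b * R * (s' - (1 - t)) :=
        mul_nonneg (mul_nonneg hb.le (by linarith)) (by linarith)
      nlinarith
    have hs : 0 ≤ s := Real.sqrt_nonneg _
    have hs' : 0 ≤ s' := Real.sqrt_nonneg _
    calc s ^ (-(l + q / 2)) * s' ^ (-(l + q / 2)) * Real.exp (-b * (R * (s + s' - 1)))
        ≤ s ^ (-(l + q / 2)) * (1 / 2) ^ (-(l + q / 2)) * Real.exp (-b * (R * (s - t))) := by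
          gcongr
      _ = (1 / 2) ^ (-(l + q / 2)) *
          (s ^ (-(l + q / 2)) * Real.exp (-b * (R * (s - t)))) := by ring
      _ ≤ (1 / 2) ^ (-(l + q / 2)) * (C * (|t| ^ (-l) * y ^ (-q))) := by gcongr
      _ = _ := by ring
  refine ⟨C * (1 / 2) ^ (-(l + q / 2)), by positivity, fun R t y hR ht0 ht1 hy0 hy => ?_⟩
  have hyq := Real.rpow_nonneg hy0 (-q)
  rcases le_total t (1 / 2) with ht | ht
  · refine (key R t y hR ht0 ?_ hy0 hy).trans ?_
    · rw [abs_of_nonneg] <;> linarith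
    · gcongr
      exact le_add_of_nonneg_right (by positivity)
  · have h := key R (1 - t) y hR (sub_ne_zero.2 ht1.symm) ?_ hy0 hy
    · rw [sub_sub_cancel] at h
      rw [mul_comm (√(t ^ 2 + y ^ 2 / R) ^ _), add_comm (√(t ^ 2 + y ^ 2 / R))]
      refine h.trans ?_
      gcongr
      exact le_add_of_nonneg_left (by positivity)
    · rw [sub_sub_cancel, abs_of_nonneg] <;> linarith

theorem exists_scaled_product_le {a a' b l q : ℝ} (hb : 0 < b) (hl : 0 ≤ l) (hq : 0 ≤ q)
    (ha : 0 ≤ a + (l + q / 2)) (ha' : 0 ≤ a' + (l + q / 2)) :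
    ∃ C > 0, ∀ R t y : ℝ, 1 ≤ R → t ≠ 0 → t ≠ 1 → 0 ≤ y → (y ≠ 0 ∨ q = 0) →
      (R ^ (-a) * ((1 + R * √((1 - t) ^ 2 + y ^ 2 / R)) ^ a *
          Real.exp (-b * (R * √((1 - t) ^ 2 + y ^ 2 / R))))) *
        (R ^ (-a') * ((1 + R * √(t ^ 2 + y ^ 2 / R)) ^ a' *
          Real.exp (-b * (R * √(t ^ 2 + y ^ 2 / R))))) * Real.exp (b * R) ≤
      C * (((|t| ^ (-l) + |1 - t| ^ (-l)) * Real.exp (-(b / 8) * |t|)) *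
        (y ^ (-q) * Real.exp (-(b / 8) * y))) := by
  obtain ⟨C₁, hC₁, h₁⟩ := exists_sqrt_rpow_mul_sqrt_rpow_mul_exp_le (half_pos hb) hl hq
  obtain ⟨C₂, hC₂, h₂⟩ := exists_rpow_le_mul_exp (m := (a + (l + q / 2)) + (a' + (l + q / 2)))
    (by positivity) (by positivity : 0 < b / 8)
  refine ⟨C₁ * C₂ * Real.exp (3 / 4 * b), by positivity, fun R t y hR ht0 ht1 hy0 hy => ?_⟩
  have hs := (abs_pos.2 ht0).trans_le (abs_le_sqrt_sq_add_sq_div hR t y)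
  have hs' := (abs_pos.2 (sub_ne_zero.2 ht1.symm)).trans_le
    (abs_le_sqrt_sq_add_sq_div hR (1 - t) y)
  have hst := sqrt_sq_add_sq_div_le hR t hy0
  have hst' := sqrt_sq_add_sq_div_le hR (1 - t) hy0
  have h1t : |1 - t| ≤ 1 + |t| := by simpa using abs_sub 1 t
  have h₃ := h₁ R t y hR ht0 ht1 hy0 hy
  have h₄ := h₂ (2 + (|t| + y)) (by positivity)
  have h₅ := abs_add_div_two_sub_one_le hR t y
  have hyq := Real.rpow_nonneg hy0 (-q)
  have hα : 0 ≤ l + q / 2 := by positivity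
  set α := l + q / 2
  set s := √(t ^ 2 + y ^ 2 / R)
  set s' := √((1 - t) ^ 2 + y ^ 2 / R)
  have hR0 : 0 < R := by linarith
  have h₆ : (1 + s') ^ (a + α) * (1 + s) ^ (a' + α) ≤
      C₂ * Real.exp (b / 8 * (2 + (|t| + y))) := by
    refine le_trans ?_ h₄
    rw [Real.rpow_add (by positivity : 0 < 2 + (|t| + y))]
    exact mul_le_mul (Real.rpow_le_rpow (by positivity) (by linarith) ha)
      (Real.rpow_le_rpow (by positivity) (by linarith) ha') (by positivity) (by positivity)
  have h₇ : Real.exp (-(b / 2) * (R * (s + s' - 1))) ≤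
      Real.exp (-(b / 2) * ((|t| + y) / 2 - 1)) := by
    apply Real.exp_le_exp.2
    nlinarith
  calc _ ≤ (s' ^ (-α) * (1 + s') ^ (a + α) * Real.exp (-b * (R * s'))) *
        (s ^ (-α) * (1 + s) ^ (a' + α) * Real.exp (-b * (R * s))) * Real.exp (b * R) := by
        refine mul_le_mul_of_nonneg_right (mul_le_mul
          (rpow_neg_mul_rpow_mul_exp_le hα ha hR hs') (rpow_neg_mul_rpow_mul_exp_le hα ha' hR hs)
          ?_ ?_) (Real.exp_pos _).le <;> positivity
    _ = (s ^ (-α) * s' ^ (-α)) * ((1 + s') ^ (a + α) * (1 + s) ^ (a' + α)) *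
        (Real.exp (-b * (R * s')) * Real.exp (-b * (R * s)) * Real.exp (b * R)) := by ring
    _ = (s ^ (-α) * s' ^ (-α)) * ((1 + s') ^ (a + α) * (1 + s) ^ (a' + α)) *
        (Real.exp (-(b / 2) * (R * (s + s' - 1))) *
          Real.exp (-(b / 2) * (R * (s + s' - 1)))) := by
        simp only [← Real.exp_add]
        congr 2
        ring
    _ = (s ^ (-α) * s' ^ (-α) * Real.exp (-(b / 2) * (R * (s + s' - 1)))) *
        ((1 + s') ^ (a + α) * (1 + s) ^ (a' + α)) *
          Real.exp (-(b / 2) * (R * (s + s' - 1))) := by ring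
    _ ≤ (C₁ * ((|t| ^ (-l) + |1 - t| ^ (-l)) * y ^ (-q))) *
        (C₂ * Real.exp (b / 8 * (2 + (|t| + y)))) *
          Real.exp (-(b / 2) * ((|t| + y) / 2 - 1)) := by gcongr
    _ = C₁ * C₂ * ((|t| ^ (-l) + |1 - t| ^ (-l)) * y ^ (-q)) *
        (Real.exp (b / 8 * (2 + (|t| + y))) * Real.exp (-(b / 2) * ((|t| + y) / 2 - 1))) := by
        ring
    _ = C₁ * C₂ * ((|t| ^ (-l) + |1 - t| ^ (-l)) * y ^ (-q)) *
        (Real.exp (3 / 4 * b) * (Real.exp (-(b / 8) * |t|) * Real.exp (-(b / 8) * y))) := by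
        simp only [← Real.exp_add]
        congr 2
        ring
    _ = _ := by ring

theorem tendsto_sqrt_sq_add_div (t Y : ℝ) :
    Tendsto (fun R : ℝ => √(t ^ 2 + Y / R)) atTop (𝓝 |t|) := by
  have h : Tendsto (fun R : ℝ => t ^ 2 + Y / R) atTop (𝓝 (t ^ 2 + 0)) :=
    tendsto_const_nhds.add (tendsto_const_nhds.div_atTop tendsto_id)
  rw [add_zero] at h
  simpa [Real.sqrt_sq_eq_abs] using h.sqrt

theorem tendsto_mul_sqrt_sq_add_div_sub {t Y : ℝ} (ht : t ≠ 0) (hY : 0 ≤ Y) :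
    Tendsto (fun R : ℝ => R * (√(t ^ 2 + Y / R) - |t|)) atTop (𝓝 (Y / (2 * |t|))) := by
  have ht' : 0 < |t| := abs_pos.2 ht
  have h : Tendsto (fun R : ℝ => Y / (√(t ^ 2 + Y / R) + |t|)) atTop (𝓝 (Y / (|t| + |t|))) :=
    tendsto_const_nhds.div ((tendsto_sqrt_sq_add_div t Y).add_const _) (by positivity)
  rw [two_mul]
  refine h.congr' ?_
  filter_upwards [eventually_gt_atTop 0] with R hR
  have hsq : √(t ^ 2 + Y / R) ^ 2 = t ^ 2 + Y / R := Real.sq_sqrt (by positivity)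
  have hs := Real.sqrt_nonneg (t ^ 2 + Y / R)
  set s := √(t ^ 2 + Y / R)
  rw [div_eq_iff (by positivity)]
  have : Y = R * (s ^ 2 - |t| ^ 2) := by
    rw [hsq, sq_abs]
    field_simp
    ring
  rw [this]
  ring

/-- The limit of the rescaled interaction integrand, at longitudinal coordinate `t` and squared
transverse distance `Y`. -/
noncomputable def scaledInteractionLimit (a a' b t Y : ℝ) : ℝ :=
  (Set.Ioo (0 : ℝ) 1).indicator
    (fun t => |1 - t| ^ a * |t| ^ a' * Real.exp (-b * (Y / (2 * |t|) + Y / (2 * |1 - t|)))) t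

theorem tendsto_exp_mul_sqrt_add_sqrt {a a' b t Y : ℝ} (hb : 0 < b) (ht0 : t ≠ 0) (ht1 : t ≠ 1)
    (hY : 0 ≤ Y) :
    Tendsto (fun R : ℝ => √((1 - t) ^ 2 + Y / R) ^ a * √(t ^ 2 + Y / R) ^ a' *
        Real.exp (-b * (R * (√(t ^ 2 + Y / R) + √((1 - t) ^ 2 + Y / R) - 1))))
      atTop (𝓝 (scaledInteractionLimit a a' b t Y)) := by
  have ht1' : 1 - t ≠ 0 := sub_ne_zero.2 ht1.symm
  have hpow := ((tendsto_sqrt_sq_add_div (1 - t) Y).rpow_const (p := a)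
    (Or.inl (abs_ne_zero.2 ht1'))).mul
      ((tendsto_sqrt_sq_add_div t Y).rpow_const (p := a') (Or.inl (abs_ne_zero.2 ht0)))
  have hsum := (tendsto_mul_sqrt_sq_add_div_sub ht0 hY).add
    (tendsto_mul_sqrt_sq_add_div_sub ht1' hY)
  by_cases ht : t ∈ Set.Ioo (0 : ℝ) 1
  · rw [scaledInteractionLimit, Set.indicator_of_mem ht]
    have hexp := (Real.continuous_exp.tendsto _).comp (hsum.const_mul (-b))
    refine (hpow.mul hexp).congr fun R => ?_
    have h₁ : |t| = t := abs_of_pos ht.1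
    have h₂ : |1 - t| = 1 - t := abs_of_pos (by linarith [ht.2])
    simp only [Function.comp_apply, h₁, h₂]
    congr 3
    ring
  · rw [scaledInteractionLimit, Set.indicator_of_notMem ht]
    have hpos : 0 < |t| + |1 - t| - 1 := by
      rw [Set.mem_Ioo, not_and_or, not_lt, not_lt] at ht
      rcases ht with ht | ht
      · have : t < 0 := lt_of_le_of_ne ht ht0
        rw [abs_of_neg this]
        linarith [le_abs_self (1 - t)]
      · have : 1 < t := lt_of_le_of_ne ht ht1.symm
        linarith [le_abs_self t, abs_pos.2 ht1']
    have htop : Tendsto (fun R : ℝ => b * (R * (√(t ^ 2 + Y / R) + √((1 - t) ^ 2 + Y / R) - 1)))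
        atTop atTop := by
      refine (Tendsto.const_mul_atTop hb (hsum.add_atTop (tendsto_id.atTop_mul_const hpos))).congr
        fun R => ?_
      simp only [id]
      ring
    have hexp := Real.tendsto_exp_neg_atTop_nhds_zero.comp htop
    have h := hpow.mul hexp
    rw [mul_zero] at h
    refine h.congr fun R => ?_
    simp only [Function.comp_apply, neg_mul]

theorem tendsto_scaled_product {U V : ℝ → ℝ} {a a' b cu cv : ℝ} (hb : 0 < b)
    (hU : Tendsto (fun r => U r / (r ^ a * Real.exp (-b * r))) atTop (𝓝 cu))
    (hV : Tendsto (fun r => V r / (r ^ a' * Real.exp (-b * r))) atTop (𝓝 cv))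
    {t Y : ℝ} (ht0 : t ≠ 0) (ht1 : t ≠ 1) (hY : 0 ≤ Y) :
    Tendsto (fun R : ℝ => (R ^ (-a) * U (R * √((1 - t) ^ 2 + Y / R))) *
        (R ^ (-a') * V (R * √(t ^ 2 + Y / R))) * Real.exp (b * R))
      atTop (𝓝 (cu * cv * scaledInteractionLimit a a' b t Y)) := by
  have hs : ∀ {t : ℝ}, t ≠ 0 → Tendsto (fun R : ℝ => R * √(t ^ 2 + Y / R)) atTop atTop :=
    fun ht => tendsto_id.atTop_mul_pos (abs_pos.2 ht) (tendsto_sqrt_sq_add_div _ Y)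
  have ht1' : 1 - t ≠ 0 := sub_ne_zero.2 ht1.symm
  refine (((hU.comp (hs ht1')).mul (hV.comp (hs ht0))).mul
    (tendsto_exp_mul_sqrt_add_sqrt (a := a) (a' := a') hb ht0 ht1 hY)).congr' ?_
  filter_upwards [eventually_gt_atTop 0] with R hR
  have hs : 0 < √(t ^ 2 + Y / R) := Real.sqrt_pos.2 (by positivity)
  have hs' : 0 < √((1 - t) ^ 2 + Y / R) := Real.sqrt_pos.2 (by positivity)
  simp only [Function.comp_apply]
  set s := √(t ^ 2 + Y / R)
  set s' := √((1 - t) ^ 2 + Y / R)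
  have he : Real.exp (-b * (R * (s + s' - 1))) =
      Real.exp (-b * (R * s')) * Real.exp (-b * (R * s)) * Real.exp (b * R) := by
    simp only [← Real.exp_add]
    congr 1
    ring
  rw [he, Real.mul_rpow hR.le hs.le, Real.mul_rpow hR.le hs'.le, Real.rpow_neg hR.le,
    Real.rpow_neg hR.le]
  field_simp

theorem exists_tendsto_interaction_integral {E : Type*} [NormedAddCommGroup E] [NormedSpace ℝ E]
    [FiniteDimensional ℝ E] [MeasurableSpace E] [BorelSpace E] (μ : Measure E)
    [μ.IsAddHaarMeasure] {U V : ℝ → ℝ} {a a' b cu cv : ℝ} (hb : 0 < b)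
    (ha : -(((Module.finrank ℝ E : ℝ) + 2) / 2) < a)
    (ha' : -(((Module.finrank ℝ E : ℝ) + 2) / 2) < a')
    (hUc : Continuous U) (hVc : Continuous V) (hU0 : ∀ r, 0 ≤ U r) (hV0 : ∀ r, 0 ≤ V r)
    (hcu : 0 < cu) (hcv : 0 < cv)
    (hU : Tendsto (fun r => U r / (r ^ a * Real.exp (-b * r))) atTop (𝓝 cu))
    (hV : Tendsto (fun r => V r / (r ^ a' * Real.exp (-b * r))) atTop (𝓝 cv)) :
    ∃ C > 0, Tendsto (fun R : ℝ => (∫ z : ℝ × E,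
        U (√((z.1 - R) ^ 2 + ‖z.2‖ ^ 2)) * V (√(z.1 ^ 2 + ‖z.2‖ ^ 2)) ∂(volume.prod μ)) /
          (Real.exp (-b * R) * R ^ (a + a' + ((Module.finrank ℝ E : ℝ) + 2) / 2)))
      atTop (𝓝 C) := by
  set d := Module.finrank ℝ E with hd
  let J : ℝ → ℝ × E → ℝ := fun R z =>
    (R ^ (-a) * U (R * √((1 - z.1) ^ 2 + ‖z.2‖ ^ 2 / R))) *
      (R ^ (-a') * V (R * √(z.1 ^ 2 + ‖z.2‖ ^ 2 / R))) * Real.exp (b * R)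
  let g : ℝ × E → ℝ := fun z => cu * cv * scaledInteractionLimit a a' b z.1 (‖z.2‖ ^ 2)
  obtain ⟨l, hl0, hl1, hla, hla'⟩ : ∃ l : ℝ, 0 ≤ l ∧ l < 1 ∧ 0 ≤ a + (l + d * l / 2) ∧
      0 ≤ a' + (l + d * l / 2) := by
    obtain ⟨α, hα, hα'⟩ := exists_between
      (max_lt (max_lt (neg_lt.1 ha) (neg_lt.1 ha')) (by positivity : 0 < ((d : ℝ) + 2) / 2))
    simp only [max_lt_iff] at hα
    have hl : α / ((d + 2) / 2) + d * (α / ((d + 2) / 2)) / 2 = α := by field_simp; ring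
    refine ⟨α / ((d + 2) / 2), div_nonneg hα.2.le (by positivity),
      (div_lt_one (by positivity)).2 hα', ?_, ?_⟩ <;> rw [hl] <;> linarith
  obtain ⟨K, hK, hUK⟩ := exists_le_mul_one_add_rpow_mul_exp hUc hU
  obtain ⟨K', hK', hVK⟩ := exists_le_mul_one_add_rpow_mul_exp hVc hV
  obtain ⟨C, hC, hJC⟩ := exists_scaled_product_le (l := l) (q := d * l) hb hl0 (by positivity)
    hla hla'
  let G : ℝ × E → ℝ := fun z => K * K' * (C *
    (((|z.1| ^ (-l) + |1 - z.1| ^ (-l)) * Real.exp (-(b / 8) * |z.1|)) *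
      (‖z.2‖ ^ (-(d * l)) * Real.exp (-(b / 8) * ‖z.2‖))))
  have hGint : Integrable G (volume.prod μ) := by
    have h₁ : Integrable (fun t : ℝ => |t| ^ (-l) * Real.exp (-(b / 8) * |t|)) := by
      simpa using integrable_norm_rpow_mul_exp (volume : Measure ℝ) hl1 (by positivity : 0 < b / 8)
    have h₂ := (h₁.comp_sub_left 1).const_mul (Real.exp (b / 8))
    have h₃ : Integrable (fun t : ℝ =>
        (|t| ^ (-l) + |1 - t| ^ (-l)) * Real.exp (-(b / 8) * |t|)) := by
      simp only [add_mul]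
      refine h₁.add (h₂.mono' (by fun_prop) (ae_of_all _ fun t => ?_))
      rw [Real.norm_of_nonneg (by positivity), mul_left_comm, ← Real.exp_add]
      gcongr
      have : |1 - t| ≤ 1 + |t| := by simpa using abs_sub 1 t
      nlinarith
    exact ((h₃.mul_prod (integrable_norm_rpow_mul_exp μ hl1
      (by positivity : 0 < b / 8))).const_mul C).const_mul (K * K')
  have hae : ∀ᵐ z : ℝ × E ∂(volume.prod μ),
      z.1 ≠ 0 ∧ z.1 ≠ 1 ∧ (‖z.2‖ ≠ 0 ∨ d * l = 0) := by
    have h₁ := Measure.quasiMeasurePreserving_fst (μ := (volume : Measure ℝ)) (ν := μ)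
    have h₂ := Measure.quasiMeasurePreserving_snd (μ := (volume : Measure ℝ)) (ν := μ)
    have h₃ : ∀ᵐ y ∂μ, (‖y‖ ≠ 0 ∨ d * l = 0) := by
      cases subsingleton_or_nontrivial E
      · exact ae_of_all _ fun y => Or.inr (by simp [hd, Module.finrank_zero_of_subsingleton])
      · filter_upwards [Measure.ae_ne μ 0] with y hy
        exact Or.inl (norm_ne_zero_iff.2 hy)
    filter_upwards [h₁.ae (Measure.ae_ne volume 0), h₁.ae (Measure.ae_ne volume 1), h₂.ae h₃]
      with z hz₁ hz₂ hz₃ using ⟨hz₁, hz₂, hz₃⟩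
  have hJmeas : ∀ R, AEStronglyMeasurable (J R) (volume.prod μ) := fun R =>
    Continuous.aestronglyMeasurable (by fun_prop)
  have hJG : ∀ R, 1 ≤ R → ∀ᵐ z ∂(volume.prod μ), ‖J R z‖ ≤ G z := by
    intro R hR
    have hR0 : 0 < R := by linarith
    filter_upwards [hae] with z ⟨hz₀, hz₁, hz₂⟩
    have h₁ := hU0 (R * √((1 - z.1) ^ 2 + ‖z.2‖ ^ 2 / R))
    have h₂ := hV0 (R * √(z.1 ^ 2 + ‖z.2‖ ^ 2 / R))
    have h₃ := hUK (R * √((1 - z.1) ^ 2 + ‖z.2‖ ^ 2 / R)) (by positivity)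
    have h₄ := hVK (R * √(z.1 ^ 2 + ‖z.2‖ ^ 2 / R)) (by positivity)
    rw [Real.norm_of_nonneg (by positivity)]
    calc J R z ≤ _ := mul_le_mul_of_nonneg_right (mul_le_mul
          (mul_le_mul_of_nonneg_left h₃ (by positivity))
          (mul_le_mul_of_nonneg_left h₄ (by positivity)) (by positivity) (by positivity))
          (Real.exp_pos _).le
      _ = K * K' * _ := by ring
      _ ≤ G z := mul_le_mul_of_nonneg_left
          (hJC R z.1 ‖z.2‖ hR hz₀ hz₁ (norm_nonneg _) hz₂) (by positivity)
  have hJlim : ∀ᵐ z ∂(volume.prod μ), Tendsto (fun R => J R z) atTop (𝓝 (g z)) := by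
    filter_upwards [hae] with z ⟨hz₀, hz₁, _⟩
    exact tendsto_scaled_product hb hU hV hz₀ hz₁ (by positivity)
  have hgint : Integrable g (volume.prod μ) := by
    refine hGint.mono' (aestronglyMeasurable_of_tendsto_ae atTop hJmeas hJlim) ?_
    have hJG' : ∀ᵐ z ∂(volume.prod μ), ∀ k : ℕ, ‖J (k + 1) z‖ ≤ G z :=
      ae_all_iff.2 fun k => hJG _ (by simp)
    filter_upwards [hJG', hJlim] with z hz hlim
    exact le_of_tendsto' (hlim.comp (tendsto_atTop_add_const_right _ 1
      tendsto_natCast_atTop_atTop)).norm hz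
  have hg0 : 0 ≤ g := fun z =>
    mul_nonneg (by positivity) (Set.indicator_nonneg (fun t _ => by positivity) _)
  refine ⟨∫ z, g z ∂(volume.prod μ), ?_, ?_⟩
  · rw [gt_iff_lt, integral_pos_iff_support_of_nonneg hg0 hgint]
    have hsub : Set.Ioo (0 : ℝ) 1 ×ˢ (Set.univ : Set E) ⊆ Function.support g := by
      rintro ⟨t, y⟩ ⟨ht, -⟩
      have h₁ : 0 < |t| := abs_pos.2 ht.1.ne'
      have h₂ : 0 < |1 - t| := abs_pos.2 (sub_ne_zero.2 ht.2.ne')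
      simp only [g, Function.mem_support, scaledInteractionLimit, Set.indicator_of_mem ht]
      positivity
    refine lt_of_lt_of_le ?_ (measure_mono hsub)
    rw [Measure.prod_prod, Real.volume_Ioo]
    simp [NeZero.ne]
  · refine (tendsto_integral_filter_of_dominated_convergence G (Eventually.of_forall hJmeas)
      (eventually_atTop.2 ⟨1, hJG⟩) hGint hJlim).congr' ?_
    filter_upwards [eventually_gt_atTop 0] with R hR
    have hsqrt : ∀ t r : ℝ, √((R * t) ^ 2 + (√R * r) ^ 2) = R * √(t ^ 2 + r ^ 2 / R) := by
      intro t r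
      rw [← Real.sqrt_sq hR.le, ← Real.sqrt_mul (by positivity), Real.sqrt_sq hR.le]
      congr 1
      rw [mul_pow, mul_pow, Real.sq_sqrt hR.le]
      field_simp
    have hpow : R * √R ^ d = R ^ (((d : ℝ) + 2) / 2) := by
      rw [Real.sqrt_eq_rpow, ← Real.rpow_natCast, ← Real.rpow_mul hR.le, add_div, add_comm,
        Real.rpow_add hR]
      norm_num
      left
      congr 1
      ring
    symm
    rw [integral_prod_comp_smul_smul μ _ hR (Real.sqrt_pos.2 hR), ← hd, hpow,
      ← integral_const_mul, ← integral_div]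
    congr 1 with z
    rw [norm_smul, Real.norm_of_nonneg (Real.sqrt_nonneg R), hsqrt,
      show (R * z.1 - R) ^ 2 = (R * (1 - z.1)) ^ 2 by ring, hsqrt]
    simp only [J]
    rw [Real.rpow_add hR, Real.rpow_add hR, Real.rpow_neg hR.le, Real.rpow_neg hR.le, neg_mul,
      Real.exp_neg]
    have := Real.rpow_pos_of_pos hR a
    have := Real.rpow_pos_of_pos hR a'
    have := Real.rpow_pos_of_pos hR (((d : ℝ) + 2) / 2)
    field_simp

/-- interaction integral, equal decay rates: for positive continuous radial
`u, v` with `u(x) ~ |x|^a e^{−b|x|}`, `v(x) ~ |x|^{a'} e^{−b|x|}`, `b > 0` and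
`a ≥ a' > −(N+1)/2`, one has `∫ u(x−ξ) v(x) dx ~ C e^{−b|ξ|}|ξ|^{a+a'+(N+1)/2}`. -/
theorem stmt6 {N : ℕ} (u v : EuclideanSpace ℝ (Fin N) → ℝ) (a a' b : ℝ)
    (hb : 0 < b) (haa' : a' ≤ a) (ha' : -(((N : ℝ) + 1) / 2) < a')
    (hu : Continuous u) (hv : Continuous v)
    (hupos : ∀ x, 0 < u x) (hvpos : ∀ x, 0 < v x)
    (hurad : ∀ x y : EuclideanSpace ℝ (Fin N), ‖x‖ = ‖y‖ → u x = u y)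
    (hvrad : ∀ x y : EuclideanSpace ℝ (Fin N), ‖x‖ = ‖y‖ → v x = v y)
    (cu cv : ℝ) (hcu : 0 < cu) (hcv : 0 < cv)
    (hua : Tendsto (fun x : EuclideanSpace ℝ (Fin N) =>
        u x / (‖x‖ ^ a * Real.exp (-b * ‖x‖)))
      (cocompact (EuclideanSpace ℝ (Fin N))) (𝓝 cu))
    (hva : Tendsto (fun x : EuclideanSpace ℝ (Fin N) =>
        v x / (‖x‖ ^ a' * Real.exp (-b * ‖x‖)))
      (cocompact (EuclideanSpace ℝ (Fin N))) (𝓝 cv)) :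
    ∃ C > (0 : ℝ), Tendsto (fun ξ : EuclideanSpace ℝ (Fin N) =>
        (∫ x, u (x - ξ) * v x) /
          (Real.exp (-b * ‖ξ‖) * ‖ξ‖ ^ (a + a' + ((N : ℝ) + 1) / 2)))
      (cocompact (EuclideanSpace ℝ (Fin N))) (𝓝 C) := by
  cases N with
  | zero => exact ⟨1, one_pos, by rw [cocompact_eq_bot]; exact tendsto_bot⟩
  | succ n =>
    let e : EuclideanSpace ℝ (Fin (n + 1)) := EuclideanSpace.single 0 1
    have he : ‖e‖ = 1 := by simp [e]
    have hnorm : ∀ r : ℝ, ‖r • e‖ = |r| := fun r => by rw [norm_smul, he, mul_one, Real.norm_eq_abs]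
    have htend : Tendsto (fun r : ℝ => r • e) atTop
        (cocompact (EuclideanSpace ℝ (Fin (n + 1)))) := by
      rw [← Metric.cobounded_eq_cocompact, ← comap_norm_atTop, tendsto_comap_iff]
      exact tendsto_abs_atTop_atTop.congr fun r => (hnorm r).symm
    have hprofile : ∀ {w : EuclideanSpace ℝ (Fin (n + 1)) → ℝ} {p c : ℝ},
        Tendsto (fun x => w x / (‖x‖ ^ p * Real.exp (-b * ‖x‖)))
          (cocompact (EuclideanSpace ℝ (Fin (n + 1)))) (𝓝 c) →
        Tendsto (fun r : ℝ => w (r • e) / (r ^ p * Real.exp (-b * r))) atTop (𝓝 c) := by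
      intro w p c h
      refine (h.comp htend).congr' ?_
      filter_upwards [eventually_ge_atTop 0] with r hr
      simp only [Function.comp_apply, hnorm, abs_of_nonneg hr]
    have hdim : ((Module.finrank ℝ (EuclideanSpace ℝ (Fin n)) : ℝ) + 2) / 2 =
        (((n + 1 : ℕ) : ℝ) + 1) / 2 := by
      rw [finrank_euclideanSpace_fin]
      push_cast
      ring
    obtain ⟨C, hC, hlim⟩ := exists_tendsto_interaction_integral
      (volume : Measure (EuclideanSpace ℝ (Fin n))) (U := fun r => u (r • e))
      (V := fun r => v (r • e)) hb (by rw [hdim]; exact ha'.trans_le haa') (by rwa [hdim])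
      (by fun_prop) (by fun_prop) (fun r => (hupos _).le) (fun r => (hvpos _).le) hcu hcv
      (hprofile hua) (hprofile hva)
    refine ⟨C, hC, (hlim.comp (tendsto_norm_cocompact_atTop)).congr fun ξ => ?_⟩
    rw [integral_mul_eq_integral_prod (u := u) (v := v) (U := fun r => u (r • e)) (V := fun r => v (r • e))
      (fun x => hurad _ _ (by simp [hnorm])) (fun x => hvrad _ _ (by simp [hnorm]))]
    simp only [Function.comp_apply, hdim]
    rfl
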